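/- arXiv:2206.12691 — 12 statements merged into one kernel-verified Lean document; each statement's English description precedes it below -/
import Mathlib

section
/- Let α₁, α₂, α₃, α₄ ∈ (0, π) be the sector angles of a degree-4 rigid origami vertex and let (ρ₁, ρ₂, ρ₃, ρ₄) with every ρⱼ ∈ (−π, π) satisfy the rotation-matrix closure condition. Then for each i ∈ {1,2,3,4} (indices taken modulo 4), writing T = tan(ρ_{i+2}/2), the opposite folding angles satisfy tan²(ρ_i/2) · [ (1+T²)·cos(α_{i−1}−α_i) − T²·cos(α_{i+1}−α_{i+2}) − cos(α_{i+1}+α_{i+2}) ] = −(1+T²)·cos(α_{i−1}+α_i) + T²·cos(α_{i+1}−α_{i+2}) + cos(α_{i+1}+α_{i+2}). (This is the opposite-folding-angle relation of Theorem 2, Eq. (4) of the paper, with its sign typo corrected.) -/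
open Real Matrix

/-- Rotation of ℝ³ by angle `β` about the x-axis. -/
noncomputable def Rx (β : ℝ) : Matrix (Fin 3) (Fin 3) ℝ :=
  !![1, 0, 0;
     0, Real.cos β, -Real.sin β;
     0, Real.sin β, Real.cos β]

/-- Rotation of ℝ³ by angle `β` about the z-axis. -/
noncomputable def Rz (β : ℝ) : Matrix (Fin 3) (Fin 3) ℝ :=
  !![Real.cos β, -Real.sin β, 0;
     Real.sin β, Real.cos β, 0;
     0, 0, 1]

/-- The spherical-linkage loop (closure) condition for a degree-4 origami vertex with
sector angles `α₁, α₂, α₃, α₄` and folding angles `ρ₁, ρ₂, ρ₃, ρ₄`. -/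
def ClosureCond (α₁ α₂ α₃ α₄ ρ₁ ρ₂ ρ₃ ρ₄ : ℝ) : Prop :=
  Rx ρ₁ * Rz α₁ * Rx ρ₂ * Rz α₂ * Rx ρ₃ * Rz α₃ * Rx ρ₄ * Rz α₄ = 1

/-- Closure condition, `Fin 4`-indexed version (index `j` ↔ paper index `j+1`). -/
def ClosureCondF (α ρ : Fin 4 → ℝ) : Prop :=
  ClosureCond (α 0) (α 1) (α 2) (α 3) (ρ 0) (ρ 1) (ρ 2) (ρ 3)
theorem Rx_inv (b : ℝ) : Rx b * Rx (-b) = 1 := by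
  have h := Real.sin_sq_add_cos_sq b
  ext i j
  fin_cases i <;> fin_cases j <;> simp [Rx, Matrix.mul_apply, Fin.sum_univ_three] <;> nlinarith

theorem Rz_inv (b : ℝ) : Rz b * Rz (-b) = 1 := by
  have h := Real.sin_sq_add_cos_sq b
  ext i j
  fin_cases i <;> fin_cases j <;> simp [Rz, Matrix.mul_apply, Fin.sum_univ_three] <;> nlinarith

theorem closure_cycle {a b c d p q r s : ℝ} (h : ClosureCond a b c d p q r s) :
    ClosureCond b c d a q r s p := by
  unfold ClosureCond at *
  have h2 : (Rx p * Rz a) * (Rx q * Rz b * Rx r * Rz c * Rx s * Rz d) = 1 := by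
    rw [← h]; simp only [Matrix.mul_assoc]
  rw [← mul_eq_one_comm.mp h2]; simp only [Matrix.mul_assoc]

theorem cancel_right {A B C D : Matrix (Fin 3) (Fin 3) ℝ} (h : A * B = C) (hB : B * D = 1) :
    A = C * D := by
  rw [← h, Matrix.mul_assoc, hB, Matrix.mul_one]

theorem closure_entry {a b c d p q r s : ℝ} (h : ClosureCond a b c d p q r s) :
    Real.cos d * Real.cos a - Real.sin d * Real.sin a * Real.cos p
      = Real.cos b * Real.cos c - Real.sin b * Real.sin c * Real.cos r := by
  have h := closure_cycle (closure_cycle (closure_cycle h))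
  unfold ClosureCond at h
  have h2 : Rx s * (Rz d * Rx p * Rz a * Rx q * Rz b * Rx r * Rz c) = 1 := by
    rw [← h]; simp only [Matrix.mul_assoc]
  have h3 := mul_eq_one_comm.mp h2
  have h4 := cancel_right (cancel_right (cancel_right (cancel_right (cancel_right
    (h3) (Rx_inv s)) (Rz_inv c)) (Rx_inv r)) (Rz_inv b)) (Rx_inv q)
  have h5 := congrFun (congrFun h4 0) 0
  simp [Rx, Rz, Matrix.mul_apply, Fin.sum_univ_three] at h5
  linear_combination h5

theorem relation_of_closure {a b c d p q r s : ℝ} (h : ClosureCond a b c d p q r s)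
    (hp : p ∈ Set.Ioo (-π) π) (hr : r ∈ Set.Ioo (-π) π) :
    Real.tan (p / 2) ^ 2 *
          ((1 + Real.tan (r / 2) ^ 2) * Real.cos (d - a)
            - Real.tan (r / 2) ^ 2 * Real.cos (b - c)
            - Real.cos (b + c))
        = -((1 + Real.tan (r / 2) ^ 2) * Real.cos (d + a))
            + Real.tan (r / 2) ^ 2 * Real.cos (b - c)
            + Real.cos (b + c) := by
  have key : ∀ x ∈ Set.Ioo (-π) π,
      Real.cos x * (1 + Real.tan (x / 2) ^ 2) = 1 - Real.tan (x / 2) ^ 2 := by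
    intro x hx
    have hc : Real.cos (x / 2) ≠ 0 :=
      (Real.cos_pos_of_mem_Ioo ⟨by linarith [hx.1], by linarith [hx.2]⟩).ne'
    have h1 : Real.cos x = 2 * Real.cos (x / 2) ^ 2 - 1 := by
      rw [← Real.cos_two_mul]; congr 1; ring
    have h2 := Real.sin_sq_add_cos_sq (x / 2)
    rw [Real.tan_eq_sin_div_cos, h1]
    field_simp
    rw [show Real.sin (x / 2) ^ 2 = 1 - Real.cos (x / 2) ^ 2 by linarith]
    ring
  have e := closure_entry h
  have kp := key p hp
  have kr := key r hr
  rw [Real.cos_add, Real.cos_add, Real.cos_sub, Real.cos_sub]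
  generalize Real.tan (p / 2) ^ 2 = t at *
  generalize Real.tan (r / 2) ^ 2 = u at *
  linear_combination (1 + t) * (1 + u) * e + (1 + u) * Real.sin d * Real.sin a * kp
    - (1 + t) * Real.sin b * Real.sin c * kr

/-- Theorem 2, Eq. (4): opposite-folding-angle relation for a general degree-4
rigid origami vertex. -/
theorem opposite_folding_angle_relation (α ρ : Fin 4 → ℝ)
    (hα : ∀ j, α j ∈ Set.Ioo 0 π) (hρ : ∀ j, ρ j ∈ Set.Ioo (-π) π)
    (hclose : ClosureCondF α ρ) :
    ∀ i : Fin 4,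
      Real.tan (ρ i / 2) ^ 2 *
          ((1 + Real.tan (ρ (i + 2) / 2) ^ 2) * Real.cos (α (i + 3) - α i)
            - Real.tan (ρ (i + 2) / 2) ^ 2 * Real.cos (α (i + 1) - α (i + 2))
            - Real.cos (α (i + 1) + α (i + 2)))
        = -((1 + Real.tan (ρ (i + 2) / 2) ^ 2) * Real.cos (α (i + 3) + α i))
            + Real.tan (ρ (i + 2) / 2) ^ 2 * Real.cos (α (i + 1) - α (i + 2))
            + Real.cos (α (i + 1) + α (i + 2)) := by
  intro i
  have h0 : ClosureCond (α 0) (α 1) (α 2) (α 3) (ρ 0) (ρ 1) (ρ 2) (ρ 3) := hclose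
  have h1 := closure_cycle h0
  have h2 := closure_cycle h1
  have h3 := closure_cycle h2
  fin_cases i
  · exact relation_of_closure h0 (hρ 0) (hρ 2)
  · exact relation_of_closure h1 (hρ 1) (hρ 3)
  · exact relation_of_closure h2 (hρ 2) (hρ 0)
  · exact relation_of_closure h3 (hρ 3) (hρ 1)
end

section
/- Let α₁, α₂, α₃, α₄ ∈ (0, π) be the sector angles of a degree-4 rigid origami vertex, fix ρ₄ ∈ (−π, π), and set x = tan(ρ₄/2). Assume the quadratic coefficient A := (cos(α₁−α₃−α₄) − cos α₂) + x²·(cos(α₁+α₃−α₄) − cos α₂) is nonzero. Then there are at most two values ρ₁ ∈ (−π, π) for which there exist ρ₂, ρ₃ ∈ ℝ such that (ρ₁, ρ₂, ρ₃, ρ₄) satisfies the rotation-matrix closure condition. (This expresses the Corollary that a degree-4 rigid-foldable vertex has exactly two folding modes.) -/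
open Real Matrix

lemma Rx_cancel (b : ℝ) : Rx (-b) * Rx b = 1 := by
  have := Real.sin_sq_add_cos_sq b
  ext i j
  fin_cases i <;> fin_cases j <;> simp [Rx, Matrix.mul_apply, Fin.sum_univ_three] <;> nlinarith

lemma Rz_cancel (b : ℝ) : Rz (-b) * Rz b = 1 := by
  have := Real.sin_sq_add_cos_sq b
  ext i j
  fin_cases i <;> fin_cases j <;> simp [Rz, Matrix.mul_apply, Fin.sum_univ_three] <;> nlinarith

lemma closure_scalar (α₁ α₂ α₃ α₄ ρ₁ ρ₂ ρ₃ ρ₄ : ℝ)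
    (h : ClosureCond α₁ α₂ α₃ α₄ ρ₁ ρ₂ ρ₃ ρ₄) :
    cos α₂ = cos α₁ * (cos α₄ * cos α₃ - sin α₄ * sin α₃ * cos ρ₄)
      - sin α₁ * cos ρ₁ * (sin α₄ * cos α₃ + cos α₄ * sin α₃ * cos ρ₄)
      + sin α₁ * sin α₃ * sin ρ₁ * sin ρ₄ := by
  unfold ClosureCond at h
  have hx : ∀ b, Rx b * Rx (-b) = 1 := fun b => by simpa using Rx_cancel (-b)
  have hz : ∀ b, Rz b * Rz (-b) = 1 := fun b => by simpa using Rz_cancel (-b)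
  have hx1 : ∀ b M, Rx b * (Rx (-b) * M) = M := fun b M => by rw [← mul_assoc, hx, one_mul]
  have hz1 : ∀ b M, Rz b * (Rz (-b) * M) = M := fun b M => by rw [← mul_assoc, hz, one_mul]
  have hx2 : ∀ b M, Rx (-b) * (Rx b * M) = M := fun b M => by
    rw [← mul_assoc, Rx_cancel, one_mul]
  have hz2 : ∀ b M, Rz (-b) * (Rz b * M) = M := fun b M => by
    rw [← mul_assoc, Rz_cancel, one_mul]
  have key := congrArg (fun M => Rz (-α₁) * (Rx (-ρ₁) * (M * (Rz (-α₄) * (Rx (-ρ₄) * Rz (-α₃)))))) h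
  simp only [mul_assoc, hx1, hz1, hx2, hz2, hz, mul_one, one_mul] at key
  have e := congrFun (congrFun key 0) 0
  simp [Rx, Rz, Matrix.mul_apply, Fin.sum_univ_three] at e
  linarith

lemma quad_two (P Q R : ℝ) (hP : P ≠ 0) :
    ∃ u v : ℝ, ∀ t, P * t ^ 2 + Q * t + R = 0 → t = u ∨ t = v := by
  by_cases h : ∃ u, P * u ^ 2 + Q * u + R = 0
  · obtain ⟨u, hu⟩ := h
    refine ⟨u, -Q / P - u, fun t ht => ?_⟩
    have : (t - u) * (P * (t + u) + Q) = 0 := by linear_combination ht - hu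
    rcases mul_eq_zero.1 this with h | h
    · left; linarith
    · right; field_simp; linarith
  · exact ⟨0, 0, fun t ht => (h ⟨t, ht⟩).elim⟩

lemma half_tan (r : ℝ) (hr : r ∈ Set.Ioo (-π) π) :
    (1 + tan (r / 2) ^ 2) * cos r = 1 - tan (r / 2) ^ 2 ∧
    (1 + tan (r / 2) ^ 2) * sin r = 2 * tan (r / 2) ∧ r = 2 * arctan (tan (r / 2)) := by
  have hc : 0 < cos (r / 2) :=
    cos_pos_of_mem_Ioo ⟨by linarith [hr.1], by linarith [hr.2]⟩
  have h1 : cos r = 2 * cos (r / 2) ^ 2 - 1 := by rw [← cos_two_mul]; ring_nf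
  have h2 : sin r = 2 * sin (r / 2) * cos (r / 2) := by rw [← sin_two_mul]; ring_nf
  have h3 := sin_sq_add_cos_sq (r / 2)
  refine ⟨?_, ?_, ?_⟩
  · rw [h1, tan_eq_sin_div_cos]; field_simp
    linear_combination (2 * cos (r / 2) ^ 2) * h3
  · rw [h2, tan_eq_sin_div_cos]; field_simp
    linear_combination (sin (r / 2)) * h3
  · rw [arctan_tan (by linarith [hr.1]) (by linarith [hr.2])]; ring

/-- Corollary: a degree-4 rigid-foldable vertex has at most two folding modes: for a
fixed `ρ₄`, at most two values of `ρ₁` can be completed to a closed configuration. -/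
theorem two_folding_modes (α₁ α₂ α₃ α₄ ρ₄ : ℝ)
    (hα₁ : α₁ ∈ Set.Ioo 0 π) (hα₂ : α₂ ∈ Set.Ioo 0 π)
    (hα₃ : α₃ ∈ Set.Ioo 0 π) (hα₄ : α₄ ∈ Set.Ioo 0 π)
    (hρ₄ : ρ₄ ∈ Set.Ioo (-π) π)
    (hA : (Real.cos (α₁ - α₃ - α₄) - Real.cos α₂)
        + Real.tan (ρ₄ / 2) ^ 2 * (Real.cos (α₁ + α₃ - α₄) - Real.cos α₂) ≠ 0) :
    ∃ a b : ℝ,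
      {ρ₁ : ℝ | ρ₁ ∈ Set.Ioo (-π) π ∧
        ∃ ρ₂ ρ₃ : ℝ, ClosureCond α₁ α₂ α₃ α₄ ρ₁ ρ₂ ρ₃ ρ₄} ⊆ {a, b} := by
  obtain ⟨hC4, hS4, -⟩ := half_tan ρ₄ hρ₄
  set x := tan (ρ₄ / 2) with hx
  obtain ⟨u, v, huv⟩ := quad_two _
    (4 * sin α₁ * sin α₃ * x)
    ((1 + x ^ 2) * (cos α₁ * cos α₄ * cos α₃ - sin α₁ * sin α₄ * cos α₃ - cos α₂)
      - (1 - x ^ 2) * (cos α₁ * sin α₄ * sin α₃ + sin α₁ * cos α₄ * sin α₃)) hA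
  refine ⟨2 * arctan u, 2 * arctan v, ?_⟩
  rintro r ⟨hr, ρ₂, ρ₃, h⟩
  have e := closure_scalar _ _ _ _ _ _ _ _ h
  obtain ⟨hC, hS, hr'⟩ := half_tan r hr
  set t := tan (r / 2) with ht
  have hq := huv t (by
    simp only [cos_sub, cos_add, sin_sub, sin_add]
    linear_combination (-(1 + x ^ 2) * (1 + t ^ 2)) * e
      + (1 + t ^ 2) * (cos α₁ * sin α₄ * sin α₃) * hC4
      + (1 + x ^ 2) * (sin α₁ * sin α₄ * cos α₃) * hC
      + (sin α₁ * cos α₄ * sin α₃) * ((1 + t ^ 2) * cos r * hC4 + (1 - x ^ 2) * hC)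
      - (sin α₁ * sin α₃) * ((1 + t ^ 2) * sin r * hS4 + 2 * x * hS))
  rcases hq with h | h
  · left; rw [hr', h]
  · right; rw [hr', h]; rfl
end

section
/- Let α₁, α₂, α₃, α₄ ∈ (0, π) be the sector angles of a developable degree-4 rigid origami vertex, i.e. α₁+α₂+α₃+α₄ = 2π, and let (ρ₁, ρ₂, ρ₃, ρ₄) satisfy the rotation-matrix closure condition. Then for each i ∈ {1,2,3,4} (indices modulo 4) with ρ_i, ρ_{i+2} ∈ (−π, π) and ρ_i ≠ 0, ρ_{i+2} ≠ 0, the opposite folding angles satisfy sin α_{i+1} · sin α_{i+2} / tan²(ρ_i/2) + cos(α_{i+1}−α_{i+2})/2 = sin α_{i−1} · sin α_i / tan²(ρ_{i+2}/2) + cos(α_{i−1}−α_i)/2. (Theorem 3, Eq. (9).) -/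
open Real Matrix

theorem Rx_neg (β : ℝ) : Rx β * Rx (-β) = 1 := by
  have h := Real.sin_sq_add_cos_sq β
  ext i j
  fin_cases i <;> fin_cases j <;>
    simp [Rx, Matrix.mul_apply, Fin.sum_univ_three] <;> linarith

theorem Rz_neg (β : ℝ) : Rz β * Rz (-β) = 1 := by
  have h := Real.sin_sq_add_cos_sq β
  ext i j
  fin_cases i <;> fin_cases j <;>
    simp [Rz, Matrix.mul_apply, Fin.sum_univ_three] <;> linarith

theorem closure_diag (a b c d p q r s : ℝ) (h : ClosureCond a b c d p q r s) :
    Real.cos d * Real.cos a - Real.sin d * Real.sin a * Real.cos p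
      = Real.cos b * Real.cos c - Real.sin b * Real.sin c * Real.cos r := by
  unfold ClosureCond at h
  have h1 : Rz d * (Rx p * Rz a * Rx q * Rz b * Rx r * Rz c * Rx s) = 1 :=
    mul_eq_one_comm.mp h
  have h2 : (Rz b * Rx r * Rz c * Rx s) * (Rx (-s) * Rz (-c) * Rx (-r) * Rz (-b)) = 1 := by
    calc _ = Rz b * (Rx r * (Rz c * (Rx s * Rx (-s)) * Rz (-c)) * Rx (-r)) * Rz (-b) := by
            simp only [mul_assoc]
      _ = 1 := by simp [Rx_neg, Rz_neg]
  have h3 : Rz d * Rx p * Rz a * Rx q = Rx (-s) * Rz (-c) * Rx (-r) * Rz (-b) := by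
    have h4 : (Rz d * Rx p * Rz a * Rx q) * (Rz b * Rx r * Rz c * Rx s) = 1 := by
      rw [← h1]; simp only [mul_assoc]
    exact left_inv_eq_right_inv h4 h2
  have h5 := congrFun (congrFun h3 0) 0
  simp [Rx, Rz, Matrix.mul_apply, Fin.sum_univ_three] at h5
  linarith

theorem closure_rot (a b c d p q r s : ℝ) (h : ClosureCond a b c d p q r s) :
    ClosureCond b c d a q r s p := by
  unfold ClosureCond at h ⊢
  have h1 : (Rx p * Rz a) * (Rx q * Rz b * Rx r * Rz c * Rx s * Rz d) = 1 := by
    rw [← h]; simp only [mul_assoc]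
  have h2 := mul_eq_one_comm.mp h1
  rw [← h2]; simp only [mul_assoc]

theorem half_ne (p : ℝ) (hp : p ∈ Set.Ioo (-π) π) (h0 : p ≠ 0) :
    Real.sin (p / 2) ≠ 0 := by
  intro h
  have := (Real.sin_eq_zero_iff_of_lt_of_lt (by linarith [hp.1, Real.pi_pos])
    (by linarith [hp.2, Real.pi_pos])).mp h
  exact h0 (by linarith)

theorem opp_rel (a b c d p q r s : ℝ) (h : ClosureCond a b c d p q r s)
    (hdev : a + b + c + d = 2 * π)
    (hp : p ∈ Set.Ioo (-π) π) (hr : r ∈ Set.Ioo (-π) π) (hp0 : p ≠ 0) (hr0 : r ≠ 0) :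
    Real.sin b * Real.sin c / Real.tan (p / 2) ^ 2 + Real.cos (b - c) / 2
      = Real.sin d * Real.sin a / Real.tan (r / 2) ^ 2 + Real.cos (d - a) / 2 := by
  have hd := closure_diag a b c d p q r s h
  have hs1 := half_ne p hp hp0
  have hs2 := half_ne r hr hr0
  have hc : Real.cos (b + c) = Real.cos (d + a) := by
    rw [show b + c = 2 * π - (d + a) by linarith, Real.cos_two_pi_sub]
  rw [Real.cos_add, Real.cos_add] at hc
  have e1 : Real.cos p = 1 - 2 * Real.sin (p / 2) ^ 2 := by
    rw [← Real.cos_sq_add_sin_sq (p / 2), show p = 2 * (p / 2) by ring, Real.cos_two_mul']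
    ring_nf
  have e2 : Real.cos r = 1 - 2 * Real.sin (r / 2) ^ 2 := by
    rw [← Real.cos_sq_add_sin_sq (r / 2), show r = 2 * (r / 2) by ring, Real.cos_two_mul']
    ring_nf
  rw [e1, e2] at hd
  have key : Real.sin d * Real.sin a * Real.sin (p / 2) ^ 2
      = Real.sin b * Real.sin c * Real.sin (r / 2) ^ 2 := by linarith
  have t1 : ∀ A x : ℝ, Real.sin x ≠ 0 →
      A / Real.tan x ^ 2 = A / Real.sin x ^ 2 - A := by
    intro A x hx
    rw [Real.tan_eq_sin_div_cos, div_pow, div_div_eq_mul_div, Real.cos_sq']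
    field_simp
  rw [t1 _ _ hs1, t1 _ _ hs2, Real.cos_sub, Real.cos_sub]
  have k2 : Real.sin b * Real.sin c / Real.sin (p / 2) ^ 2
      = Real.sin d * Real.sin a / Real.sin (r / 2) ^ 2 := by
    rw [div_eq_div_iff (pow_ne_zero 2 hs1) (pow_ne_zero 2 hs2)]
    linarith
  linarith

/-- Theorem 3, Eq. (9): opposite-folding-angle relation for a general developable
degree-4 rigid origami vertex. -/
theorem developable_opposite_relation (α ρ : Fin 4 → ℝ)
    (hα : ∀ j, α j ∈ Set.Ioo 0 π)
    (hdev : α 0 + α 1 + α 2 + α 3 = 2 * π)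
    (hclose : ClosureCondF α ρ) :
    ∀ i : Fin 4, ρ i ∈ Set.Ioo (-π) π → ρ (i + 2) ∈ Set.Ioo (-π) π →
      ρ i ≠ 0 → ρ (i + 2) ≠ 0 →
      Real.sin (α (i + 1)) * Real.sin (α (i + 2)) / Real.tan (ρ i / 2) ^ 2
          + Real.cos (α (i + 1) - α (i + 2)) / 2
        = Real.sin (α (i + 3)) * Real.sin (α i) / Real.tan (ρ (i + 2) / 2) ^ 2
          + Real.cos (α (i + 3) - α i) / 2 := by
  have c0 : ClosureCond _ _ _ _ _ _ _ _ := hclose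
  have c1 := closure_rot _ _ _ _ _ _ _ _ c0
  have c2 := closure_rot _ _ _ _ _ _ _ _ c1
  have c3 := closure_rot _ _ _ _ _ _ _ _ c2
  intro i
  fin_cases i
  · have o := opp_rel _ _ _ _ _ _ _ _ c0 (by linarith)
    exact o
  · have o := opp_rel _ _ _ _ _ _ _ _ c1 (by linarith)
    exact o
  · have o := opp_rel _ _ _ _ _ _ _ _ c2 (by linarith)
    exact o
  · have o := opp_rel _ _ _ _ _ _ _ _ c3 (by linarith)
    exact o
end

section
/- Let α₁, α₂, α₃, α₄ ∈ (0, π) be the sector angles of a developable, flat-foldable degree-4 origami vertex, i.e. α₁+α₂+α₃+α₄ = 2π and α₁−α₂+α₃−α₄ = 0, labeled so that α₁ ≤ α₂, α₂ < α₃ and α₂ < α₄. If (ρ₁, ρ₂, ρ₃, ρ₄) with every ρⱼ ∈ (−π, π) satisfies the rotation-matrix closure condition, then one of the following two sets of equations holds: (mode 1) ρ₁ = ρ₃, ρ₂ = −ρ₄, and cos((α₁−α₂)/2)·tan(ρ₂/2) = −cos((α₁+α₂)/2)·tan(ρ₁/2); or (mode 2) ρ₁ = −ρ₃, ρ₂ =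 ρ₄, and sin((α₁+α₂)/2)·tan(ρ₁/2) = sin((α₁−α₂)/2)·tan(ρ₂/2). -/
open Real Matrix

open Quaternion in
/-- Homogeneous rotation matrix of a quaternion. -/
noncomputable def QM (q : ℍ[ℝ]) : Matrix (Fin 3) (Fin 3) ℝ :=
  !![q.re^2+q.imI^2-q.imJ^2-q.imK^2, 2*(q.imI*q.imJ-q.re*q.imK), 2*(q.imI*q.imK+q.re*q.imJ);
     2*(q.imI*q.imJ+q.re*q.imK), q.re^2-q.imI^2+q.imJ^2-q.imK^2, 2*(q.imJ*q.imK-q.re*q.imI);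
     2*(q.imI*q.imK-q.re*q.imJ), 2*(q.imJ*q.imK+q.re*q.imI), q.re^2-q.imI^2-q.imJ^2+q.imK^2]

open Quaternion in
lemma QM_mul (p q : ℍ[ℝ]) : QM p * QM q = QM (p * q) := by
  ext i j
  fin_cases i <;> fin_cases j <;>
    simp [QM, Matrix.mul_apply, Fin.sum_univ_three] <;> ring

open Quaternion in
/-- half-angle quaternion about x -/
noncomputable def qx (r : ℝ) : ℍ[ℝ] := ⟨Real.cos (r/2), Real.sin (r/2), 0, 0⟩

open Quaternion in
/-- half-angle quaternion about z -/
noncomputable def qz (r : ℝ) : ℍ[ℝ] := ⟨Real.cos (r/2), 0, 0, Real.sin (r/2)⟩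

@[simp] lemma qx_re (r : ℝ) : (qx r).re = Real.cos (r/2) := rfl
@[simp] lemma qx_imI (r : ℝ) : (qx r).imI = Real.sin (r/2) := rfl
@[simp] lemma qx_imJ (r : ℝ) : (qx r).imJ = 0 := rfl
@[simp] lemma qx_imK (r : ℝ) : (qx r).imK = 0 := rfl
@[simp] lemma qz_re (r : ℝ) : (qz r).re = Real.cos (r/2) := rfl
@[simp] lemma qz_imI (r : ℝ) : (qz r).imI = 0 := rfl
@[simp] lemma qz_imJ (r : ℝ) : (qz r).imJ = 0 := rfl
@[simp] lemma qz_imK (r : ℝ) : (qz r).imK = Real.sin (r/2) := rfl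

lemma cos_half' (r : ℝ) : Real.cos r = Real.cos (r/2)^2 - Real.sin (r/2)^2 := by
  rw [← Real.cos_two_mul']; congr 1; ring

lemma sin_half' (r : ℝ) : Real.sin r = 2 * (Real.cos (r/2) * Real.sin (r/2)) := by
  have := Real.sin_two_mul (r/2)
  rw [show 2 * (r/2) = r by ring] at this
  rw [this]; ring

lemma Rx_eq (r : ℝ) : Rx r = QM (qx r) := by
  ext i j
  fin_cases i <;> fin_cases j <;> simp [QM, Rx, cos_half' r, sin_half' r] <;> ring

lemma Rz_eq (r : ℝ) : Rz r = QM (qz r) := by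
  ext i j
  fin_cases i <;> fin_cases j <;> simp [QM, Rz, cos_half' r, sin_half' r] <;> ring

lemma qx_star (r : ℝ) : qx r * star (qx r) = 1 := by
  have h := Real.cos_sq_add_sin_sq (r/2)
  ext <;> simp [Quaternion.re_one, Quaternion.imI_one, Quaternion.imJ_one, Quaternion.imK_one] <;> linarith

lemma qz_star (r : ℝ) : qz r * star (qz r) = 1 := by
  have h := Real.cos_sq_add_sin_sq (r/2)
  ext <;> simp [Quaternion.re_one, Quaternion.imI_one, Quaternion.imJ_one, Quaternion.imK_one] <;> linarith

open Quaternion in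
lemma QM_one (q : ℍ[ℝ]) (h : QM q = 1) (hn : q * star q = 1) :
    ∃ w : ℝ, w^2 = 1 ∧ q = (w : ℍ[ℝ]) := by
  have h0 := congrFun (congrFun h 0) 0
  have h1 := congrFun (congrFun h 1) 1
  have h2 := congrFun (congrFun h 2) 2
  have hr := congrArg QuaternionAlgebra.re hn
  simp [QM] at h0 h1 h2 hr
  have hx : q.imI = 0 := by
    have : q.imI^2 = 0 := by nlinarith
    simpa using this
  have hy : q.imJ = 0 := by
    have : q.imJ^2 = 0 := by nlinarith
    simpa using this
  have hz : q.imK = 0 := by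
    have : q.imK^2 = 0 := by nlinarith
    simpa using this
  refine ⟨q.re, ?_, ?_⟩
  · rw [hx, hy, hz] at h0; linarith
  · ext <;> simp [hx, hy, hz]

open Quaternion in
lemma closure_quat (a b c d r1 r2 r3 r4 : ℝ) (h : ClosureCond a b c d r1 r2 r3 r4) :
    ∃ w : ℝ, w^2 = 1 ∧ qx r1 * qz a * qx r2 * qz b
      = (w : ℍ[ℝ]) * (star (qz d) * star (qx r4) * star (qz c) * star (qx r3)) := by
  unfold ClosureCond at h
  simp only [Rx_eq, Rz_eq, QM_mul] at h
  have key : ∀ p q : ℍ[ℝ], p * star p = 1 → q * star q = 1 → (p*q) * star (p*q) = 1 := by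
    intro p q hp hq
    rw [star_mul, mul_assoc, ← mul_assoc q, hq, one_mul, hp]
  have hS : (qx r3 * qz c * qx r4 * qz d) * star (qx r3 * qz c * qx r4 * qz d) = 1 := by
    refine key _ _ (key _ _ (key _ _ ?_ ?_) ?_) ?_ <;> first | apply qx_star | apply qz_star
  have hL : (qx r1 * qz a * qx r2 * qz b) * star (qx r1 * qz a * qx r2 * qz b) = 1 := by
    refine key _ _ (key _ _ (key _ _ ?_ ?_) ?_) ?_ <;> first | apply qx_star | apply qz_star
  have e : qx r1 * qz a * qx r2 * qz b * qx r3 * qz c * qx r4 * qz d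
    = (qx r1 * qz a * qx r2 * qz b) * (qx r3 * qz c * qx r4 * qz d) := by
    simp only [mul_assoc]
  rw [e] at h
  obtain ⟨w, hw, hq⟩ := QM_one _ h (key _ _ hL hS)
  refine ⟨w, hw, ?_⟩
  rw [← hq]
  have : star (qz d) * star (qx r4) * star (qz c) * star (qx r3)
      = star (qx r3 * qz c * qx r4 * qz d) := by
    simp only [star_mul, mul_assoc]
  rw [this, mul_assoc (qx r1 * qz a * qx r2 * qz b), hS, mul_one]

lemma half_eq {x y : ℝ} (hx : x ∈ Set.Ioo (-π) π) (hy : y ∈ Set.Ioo (-π) π)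
    (h : Real.sin (x/2) = Real.sin (y/2)) : x = y := by
  have := Real.injOn_sin (x₁ := x/2) (x₂ := y/2) ⟨by linarith [hx.1], by linarith [hx.2]⟩
    ⟨by linarith [hy.1], by linarith [hy.2]⟩ h
  linarith

lemma half_eq_neg {x y : ℝ} (hx : x ∈ Set.Ioo (-π) π) (hy : y ∈ Set.Ioo (-π) π)
    (h : Real.sin (x/2) = -Real.sin (y/2)) : x = -y := by
  apply half_eq hx ⟨by linarith [hy.2], by linarith [hy.1]⟩
  rw [h, neg_div, Real.sin_neg]

lemma half_cos_pos {x : ℝ} (hx : x ∈ Set.Ioo (-π) π) : 0 < Real.cos (x/2) :=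
  Real.cos_pos_of_mem_Ioo ⟨by linarith [hx.1], by linarith [hx.2]⟩

/-- Theorem 1: the two folding modes of a developable, flat-foldable degree-4 vertex. -/
theorem flat_foldable_two_modes (α₁ α₂ α₃ α₄ ρ₁ ρ₂ ρ₃ ρ₄ : ℝ)
    (hα₁ : α₁ ∈ Set.Ioo 0 π) (hα₂ : α₂ ∈ Set.Ioo 0 π)
    (hα₃ : α₃ ∈ Set.Ioo 0 π) (hα₄ : α₄ ∈ Set.Ioo 0 π)
    (hdev : α₁ + α₂ + α₃ + α₄ = 2 * π)
    (hff : α₁ - α₂ + α₃ - α₄ = 0)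
    (h12 : α₁ ≤ α₂) (h23 : α₂ < α₃) (h24 : α₂ < α₄)
    (hρ₁ : ρ₁ ∈ Set.Ioo (-π) π) (hρ₂ : ρ₂ ∈ Set.Ioo (-π) π)
    (hρ₃ : ρ₃ ∈ Set.Ioo (-π) π) (hρ₄ : ρ₄ ∈ Set.Ioo (-π) π)
    (hclose : ClosureCond α₁ α₂ α₃ α₄ ρ₁ ρ₂ ρ₃ ρ₄) :
    (ρ₁ = ρ₃ ∧ ρ₂ = -ρ₄ ∧
      Real.cos ((α₁ - α₂) / 2) * Real.tan (ρ₂ / 2)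
        = -(Real.cos ((α₁ + α₂) / 2) * Real.tan (ρ₁ / 2)))
    ∨ (ρ₁ = -ρ₃ ∧ ρ₂ = ρ₄ ∧
      Real.sin ((α₁ + α₂) / 2) * Real.tan (ρ₁ / 2)
        = Real.sin ((α₁ - α₂) / 2) * Real.tan (ρ₂ / 2)) := by
  obtain ⟨w, hw, hq⟩ := closure_quat _ _ _ _ _ _ _ _ hclose
  have e3 : α₃ = π - α₁ := by linarith
  have e4 : α₄ = π - α₂ := by linarith
  subst e3 e4
  have q0 := congrArg QuaternionAlgebra.re hq
  have q1 := congrArg QuaternionAlgebra.imI hq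
  have q2 := congrArg QuaternionAlgebra.imJ hq
  have q3 := congrArg QuaternionAlgebra.imK hq
  have s1 : ∀ x : ℝ, Real.cos ((π - x)/2) = Real.sin (x/2) := fun x => by
    rw [sub_div, Real.cos_pi_div_two_sub]
  have s2 : ∀ x : ℝ, Real.sin ((π - x)/2) = Real.cos (x/2) := fun x => by
    rw [sub_div, Real.sin_pi_div_two_sub]
  simp [s1, s2] at q0 q1 q2 q3
  clear hq hclose
  have c1p := half_cos_pos hρ₁
  have c2p := half_cos_pos hρ₂
  have c3p := half_cos_pos hρ₃
  have c4p := half_cos_pos hρ₄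
  have hm : 0 < Real.cos ((α₁ - α₂)/2) := half_cos_pos
    ⟨by linarith [hα₁.1, hα₂.2], by linarith [hα₁.2, hα₂.1]⟩
  have hsa := Real.sin_pos_of_pos_of_lt_pi hα₁.1 hα₁.2
  have hsb := Real.sin_pos_of_pos_of_lt_pi hα₂.1 hα₂.2
  rw [sin_half'] at hsa hsb
  have n1 := Real.cos_sq_add_sin_sq (ρ₁/2)
  have n2 := Real.cos_sq_add_sin_sq (ρ₂/2)
  have n3 := Real.cos_sq_add_sin_sq (ρ₃/2)
  have n4 := Real.cos_sq_add_sin_sq (ρ₄/2)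
  have na := Real.cos_sq_add_sin_sq (α₁/2)
  have nb := Real.cos_sq_add_sin_sq (α₂/2)
  simp only [Real.tan_eq_sin_div_cos]
  have I1 := @half_eq _ _ hρ₁ hρ₃
  have I2 := @half_eq _ _ hρ₂ hρ₄
  have J1 := @half_eq_neg _ _ hρ₁ hρ₃
  have J2 := @half_eq_neg _ _ hρ₂ hρ₄
  rw [show (α₁ - α₂)/2 = α₁/2 - α₂/2 by ring] at *
  rw [show (α₁ + α₂)/2 = α₁/2 + α₂/2 by ring]
  simp only [Real.cos_sub, Real.cos_add, Real.sin_sub, Real.sin_add] at *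
  generalize Real.cos (ρ₁/2) = c1 at *
  generalize Real.cos (ρ₂/2) = c2 at *
  generalize Real.cos (ρ₃/2) = c3 at *
  generalize Real.cos (ρ₄/2) = c4 at *
  generalize Real.sin (ρ₁/2) = s1 at *
  generalize Real.sin (ρ₂/2) = s2 at *
  generalize Real.sin (ρ₃/2) = s3 at *
  generalize Real.sin (ρ₄/2) = s4 at *
  generalize Real.cos (α₁/2) = ca at *
  generalize Real.cos (α₂/2) = cb at *
  generalize Real.sin (α₁/2) = sa at *
  generalize Real.sin (α₂/2) = sb at *
  obtain ⟨cp, hcp⟩ : ∃ x, x = ca*cb - sa*sb := ⟨_, rfl⟩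
  obtain ⟨cm, hcm⟩ : ∃ x, x = ca*cb + sa*sb := ⟨_, rfl⟩
  obtain ⟨sp, hsp⟩ : ∃ x, x = sa*cb + ca*sb := ⟨_, rfl⟩
  obtain ⟨sm, hsm⟩ : ∃ x, x = sa*cb - ca*sb := ⟨_, rfl⟩
  have Q0 : c1*c2*cp - s1*s2*cm = -w*(c3*c4*cp + s3*s4*cm) := by
    rw [hcp, hcm]; linear_combination q0
  have Q1 : s1*c2*cp + c1*s2*cm = -w*(c3*s4*cm - s3*c4*cp) := by
    rw [hcp, hcm]; linear_combination q1
  have Q2 : c1*s2*sm - s1*c2*sp = -w*(-c3*s4*sm - s3*c4*sp) := by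
    rw [hsp, hsm]; linear_combination q2
  have Q3 : c1*c2*sp + s1*s2*sm = -w*(c3*c4*sp - s3*s4*sm) := by
    rw [hsp, hsm]; linear_combination q3
  have e1 : sp*cm + cp*sm = 2*(ca*sa) := by
    rw [hcp, hcm, hsp, hsm]; linear_combination (2*ca*sa)*nb
  have e2 : cm^2 - cp^2 = (2*(ca*sa))*(2*(cb*sb)) := by
    rw [hcp, hcm]; ring
  rw [← hcp, ← hcm, ← hsp, ← hsm]
  rw [← hcm] at hm
  clear q0 q1 q2 q3 hcp hcm hsp hsm
  have hK : (c1*c2 + w*(c3*c4)) * (2*(ca*sa)) = 0 := by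
    rw [← e1]; linear_combination sm*Q0 + cm*Q3
  have hK' : c1*c2 + w*(c3*c4) = 0 := by
    rcases mul_eq_zero.1 hK with h | h
    · exact h
    · linarith
  have hw' : w = -1 := by
    have : (w-1)*(w+1) = 0 := by linarith
    rcases mul_eq_zero.1 this with h | h
    · have : w = 1 := by linarith
      subst this
      have := mul_pos c1p c2p
      have := mul_pos c3p c4p
      linarith
    · linarith
  subst hw'
  have hss : s1*s2 + s3*s4 = 0 := by
    have : (s1*s2 + s3*s4)*cm = 0 := by linear_combination cp*hK' - Q0
    rcases mul_eq_zero.1 this with h | h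
    · exact h
    · linarith
  have hc24 : c2 = c4 := by
    have h : (c4^2 - c2^2)*(cm^2-cp^2) = 0 := by
      linear_combination (c1*c2*cp - s1*s2*cm + (c3*c4*cp + s3*s4*cm))*Q0
        + (s1*c2*cp + c1*s2*cm + (c3*s4*cm - s3*c4*cp))*Q1
        - (cp^2*c2^2+cm^2*s2^2)*n1 + (cp^2*c4^2+cm^2*s4^2)*n3 - cm^2*n2 + cm^2*n4
    rw [e2] at h
    rcases mul_eq_zero.1 h with h | h
    · have : (c4-c2)*(c4+c2) = 0 := by linarith
      rcases mul_eq_zero.1 this with h | h <;> linarith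
    · have := mul_pos hsa hsb
      linarith
  subst hc24
  have hc13 : c1 = c3 := by
    apply mul_right_cancel₀ c2p.ne'
    linarith
  subst hc13
  have h24 : s2 = s4 → s1 = -s3 → (ρ₁ = -ρ₃ ∧ ρ₂ = ρ₄ ∧ sp * (s1/c1) = sm * (s2/c2)) := by
    intro h h'
    refine ⟨J1 h', I2 h, ?_⟩
    subst h
    field_simp
    rw [h'] at Q2 ⊢
    linarith
  have hs13 : (s1 - s3)*(s1+s3) = 0 := by linarith
  rcases mul_eq_zero.1 hs13 with h | h
  · have h13 : s1 = s3 := by linarith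
    subst h13
    have h' : s1*(s2+s4) = 0 := by linarith
    rcases mul_eq_zero.1 h' with h' | h'
    · right
      apply h24 _ (by linarith)
      apply mul_right_cancel₀ (mul_pos c1p hm).ne'
      rw [h'] at Q1
      linarith
    · left
      have h4 : s4 = -s2 := by linarith
      refine ⟨I1 rfl, J2 (by linarith), ?_⟩
      rw [h4] at Q1
      field_simp
      linarith
  · right
    have h3 : s3 = -s1 := by linarith
    apply h24 _ (by linarith)
    apply mul_right_cancel₀ (mul_pos c1p hm).ne'
    rw [h3] at Q1
    linarith
end

section
/- Let α₁, α₂, α₃, α₄ ∈ (0, π) satisfy α₁+α₂+α₃+α₄ = 2π and α₁−α₂+α₃−α₄ = 0 (a developable, flat-foldable degree-4 vertex), labeled so that α₁ ≤ α₂, α₂ < α₃ and α₂ < α₄. Suppose ρ₁, ρ₂ ∈ (−π, π) satisfy the mode-1 relation cos((α₁−α₂)/2)·tan(ρ₂/2) = −cos((α₁+α₂)/2)·tan(ρ₁/2). Then the tuple (ρ₁, ρ₂, ρ₃, ρ₄) with ρ₃ = ρ₁ and ρ₄ = −ρ₂ satisfies the rotation-matrix closure condition; that is, the mode-1 curve lies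 in the configuration space of the vertex. -/
open Real Matrix

/-- Matrix of (conjugation by) a quaternion. -/
def Qm (a b c d : ℝ) : Matrix (Fin 3) (Fin 3) ℝ :=
  !![a^2+b^2-c^2-d^2, 2*(b*c-a*d), 2*(b*d+a*c);
     2*(b*c+a*d), a^2-b^2+c^2-d^2, 2*(c*d-a*b);
     2*(b*d-a*c), 2*(c*d+a*b), a^2-b^2-c^2+d^2]

lemma Qm_mul (a b c d a' b' c' d' : ℝ) : Qm a b c d * Qm a' b' c' d' =
    Qm (a*a'-b*b'-c*c'-d*d') (a*b'+b*a'+c*d'-d*c') (a*c'-b*d'+c*a'+d*b')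
      (a*d'+b*c'-c*b'+d*a') := by
  ext i j
  fin_cases i <;> fin_cases j <;> simp [Qm, Matrix.mul_apply, Fin.sum_univ_three] <;> ring

lemma Rx_eq_s6 (r : ℝ) : Rx r = Qm (cos (r/2)) (sin (r/2)) 0 0 := by
  have h1 : cos r = cos (r/2)^2 - sin (r/2)^2 := by
    rw [← cos_two_mul']; congr 1; ring
  have h2 : sin r = 2 * sin (r/2) * cos (r/2) := by
    rw [← sin_two_mul]; congr 1; ring
  have h3 := sin_sq_add_cos_sq (r/2)
  ext i j
  fin_cases i <;> fin_cases j <;> simp [Qm, Rx, h1, h2] <;> linarith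

lemma Rz_eq_s6 (r : ℝ) : Rz r = Qm (cos (r/2)) 0 0 (sin (r/2)) := by
  have h1 : cos r = cos (r/2)^2 - sin (r/2)^2 := by
    rw [← cos_two_mul']; congr 1; ring
  have h2 : sin r = 2 * sin (r/2) * cos (r/2) := by
    rw [← sin_two_mul]; congr 1; ring
  have h3 := sin_sq_add_cos_sq (r/2)
  ext i j
  fin_cases i <;> fin_cases j <;> simp [Qm, Rz, h1, h2] <;> linarith

lemma Qm_one (a b c d : ℝ) (h : a^2+b^2+c^2+d^2 = 1) :
    Qm a b c d * Qm (-a) b c d = 1 := by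
  have h2 : (a^2+b^2+c^2+d^2)^2 = 1 := by rw [h]; norm_num
  rw [Qm_mul]
  ext i j
  fin_cases i <;> fin_cases j <;> simp [Qm] <;> linarith

/-- The mode-1 curve of a developable, flat-foldable degree-4 vertex lies in its
configuration space. -/
theorem mode1_in_config_space (α₁ α₂ α₃ α₄ ρ₁ ρ₂ : ℝ)
    (hα₁ : α₁ ∈ Set.Ioo 0 π) (hα₂ : α₂ ∈ Set.Ioo 0 π)
    (hα₃ : α₃ ∈ Set.Ioo 0 π) (hα₄ : α₄ ∈ Set.Ioo 0 π)
    (hdev : α₁ + α₂ + α₃ + α₄ = 2 * π)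
    (hff : α₁ - α₂ + α₃ - α₄ = 0)
    (h12 : α₁ ≤ α₂) (h23 : α₂ < α₃) (h24 : α₂ < α₄)
    (hρ₁ : ρ₁ ∈ Set.Ioo (-π) π) (hρ₂ : ρ₂ ∈ Set.Ioo (-π) π)
    (hmode1 : Real.cos ((α₁ - α₂) / 2) * Real.tan (ρ₂ / 2)
      = -(Real.cos ((α₁ + α₂) / 2) * Real.tan (ρ₁ / 2))) :
    ClosureCond α₁ α₂ α₃ α₄ ρ₁ ρ₂ ρ₁ (-ρ₂) := by
  have e3 : α₃ / 2 = π / 2 - α₁ / 2 := by linarith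
  have e4 : α₄ / 2 = π / 2 - α₂ / 2 := by linarith
  have c1 : cos (ρ₁ / 2) ≠ 0 :=
    (cos_pos_of_mem_Ioo ⟨by linarith [hρ₁.1], by linarith [hρ₁.2]⟩).ne'
  have c2 : cos (ρ₂ / 2) ≠ 0 :=
    (cos_pos_of_mem_Ioo ⟨by linarith [hρ₂.1], by linarith [hρ₂.2]⟩).ne'
  have f1 : (α₁ - α₂) / 2 = α₁ / 2 - α₂ / 2 := by ring
  have f2 : (α₁ + α₂) / 2 = α₁ / 2 + α₂ / 2 := by ring
  rw [f1, f2, cos_sub, cos_add, tan_eq_sin_div_cos, tan_eq_sin_div_cos] at hmode1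
  field_simp at hmode1
  have g1 := sin_sq_add_cos_sq (ρ₁ / 2)
  have g2 := sin_sq_add_cos_sq (ρ₂ / 2)
  have k1 := sin_sq_add_cos_sq (α₁ / 2)
  have k2 := sin_sq_add_cos_sq (α₂ / 2)
  unfold ClosureCond
  simp only [Rx_eq_s6, Rz_eq_s6, e3, e4, cos_pi_div_two_sub, sin_pi_div_two_sub, neg_div, cos_neg,
    sin_neg]
  generalize cos (ρ₁ / 2) = p at *
  generalize sin (ρ₁ / 2) = q at *
  generalize cos (ρ₂ / 2) = r at *
  generalize sin (ρ₂ / 2) = s at *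
  generalize cos (α₁ / 2) = x at *
  generalize sin (α₁ / 2) = y at *
  generalize cos (α₂ / 2) = z at *
  generalize sin (α₂ / 2) = w at *
  have hm : s * (x*z+y*w) * p + r * (x*z-y*w) * q = 0 := by linear_combination hmode1
  have H1 : Qm p q 0 0 * Qm x 0 0 y * Qm r s 0 0 * Qm z 0 0 w * Qm p q 0 0 =
      Qm (r*(x*z-y*w)) (-(s*(x*z+y*w))) (s*(y*z-x*w)) (r*(x*w+y*z)) := by
    simp only [Qm_mul]
    congr 1
    · linear_combination (r*(x*z-y*w)) * g1 - 2 * q * hm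
    · linear_combination (-(s*(x*z+y*w))) * g1 + 2 * p * hm
    · linear_combination (s*(y*z-x*w)) * g1
    · linear_combination (r*(x*w+y*z)) * g1
  have H2 : Qm y 0 0 x * Qm r (-s) 0 0 * Qm w 0 0 z =
      Qm (-(r*(x*z-y*w))) (-(s*(x*z+y*w))) (s*(y*z-x*w)) (r*(x*w+y*z)) := by
    simp only [Qm_mul]
    congr 1 <;> ring
  rw [H1, Matrix.mul_assoc, Matrix.mul_assoc, ← Matrix.mul_assoc (Qm y 0 0 x), H2]
  apply Qm_one
  have : (r*(x*z-y*w))^2 + (-(s*(x*z+y*w)))^2 + (s*(y*z-x*w))^2 + (r*(x*w+y*z))^2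
    = (s^2+r^2)*(y^2+x^2)*(w^2+z^2) := by ring
  rw [this, g2, k1, k2]; norm_num
end

section
/- Consider a developable bird's-foot degree-4 rigid origami vertex: sector angles α₁ = α₂ = α ∈ (0, π) and α₃ = α₄ = π − α. If (ρ₁, ρ₂, ρ₃, ρ₄) satisfies the rotation-matrix closure condition with ρ₁, ρ₄ ∈ (−π, π), then tan(ρ₁/2) · [ (cos α − cos 3α) · tan(ρ₁/2) − 4 · sin²α · tan(ρ₄/2) ] = 0. -/
open Real Matrix

theorem Rx_inv_aux (b : ℝ) : Rx (-b) * Rx b = 1 ∧ Rx b * Rx (-b) = 1 := by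
  have := Real.sin_sq_add_cos_sq b
  constructor <;>
  · ext i j
    fin_cases i <;> fin_cases j <;>
      simp [Rx, Matrix.mul_apply, Fin.sum_univ_three] <;> nlinarith

theorem Rz_inv_aux (b : ℝ) : Rz (-b) * Rz b = 1 ∧ Rz b * Rz (-b) = 1 := by
  have := Real.sin_sq_add_cos_sq b
  constructor <;>
  · ext i j
    fin_cases i <;> fin_cases j <;>
      simp [Rz, Matrix.mul_apply, Fin.sum_univ_three] <;> nlinarith

theorem mid_aux {M : Type*} [Monoid M] {a b d e f a' b' d' e' f' m : M}
    (ha : a' * a = 1) (hb : b' * b = 1) (hd : d * d' = 1) (he : e * e' = 1) (hf : f * f' = 1)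
    (h : a * b * m * d * e * f = 1) : m = b' * a' * f' * e' * d' := by
  calc m = (b' * ((a' * a) * b)) * m * (d * ((e * ((f * f') * e')) * d')) := by
        simp [ha, hb, hd, he, hf]
    _ = b' * a' * (a * b * m * d * e * f) * f' * e' * d' := by simp only [mul_assoc]
    _ = _ := by rw [h, mul_one]

/-- Eq. (7): factored folding-angle relation for a developable bird's-foot
(Miura-ori) degree-4 vertex. -/
theorem miura_vertex_factored (α ρ₁ ρ₂ ρ₃ ρ₄ : ℝ)
    (hα : α ∈ Set.Ioo 0 π)
    (hρ₁ : ρ₁ ∈ Set.Ioo (-π) π) (hρ₄ : ρ₄ ∈ Set.Ioo (-π) π)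
    (hclose : ClosureCond α α (π - α) (π - α) ρ₁ ρ₂ ρ₃ ρ₄) :
    Real.tan (ρ₁ / 2) *
        ((Real.cos α - Real.cos (3 * α)) * Real.tan (ρ₁ / 2)
          - 4 * Real.sin α ^ 2 * Real.tan (ρ₄ / 2)) = 0 := by
  unfold ClosureCond at hclose
  have h1 : Rx ρ₁ * Rz α * (Rx ρ₂ * Rz α * Rx ρ₃) * Rz (π - α) * Rx ρ₄ * Rz (π - α) = 1 := by
    simpa only [mul_assoc] using hclose
  have h2 := mid_aux (Rx_inv_aux ρ₁).1 (Rz_inv_aux α).1 (Rz_inv_aux (π - α)).2 (Rx_inv_aux ρ₄).2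
    (Rz_inv_aux (π - α)).2 h1
  have h3 := congrFun (congrFun h2 0) 0
  have c1 : Real.cos (ρ₁ / 2) ≠ 0 :=
    (Real.cos_pos_of_mem_Ioo ⟨by linarith [hρ₁.1], by linarith [hρ₁.2]⟩).ne'
  have c4 : Real.cos (ρ₄ / 2) ≠ 0 :=
    (Real.cos_pos_of_mem_Ioo ⟨by linarith [hρ₄.1], by linarith [hρ₄.2]⟩).ne'
  have e1 : ρ₁ = 2 * (ρ₁ / 2) := by ring
  have e4 : ρ₄ = 2 * (ρ₄ / 2) := by ring
  simp only [Rx, Rz, Matrix.mul_apply, Fin.sum_univ_three, Real.cos_neg, Real.sin_neg,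
    Real.cos_pi_sub, Real.sin_pi_sub] at h3
  simp at h3
  rw [e1, e4] at h3
  generalize ρ₁ / 2 = x at *
  generalize ρ₄ / 2 = y at *
  rw [Real.cos_three_mul, Real.tan_eq_sin_div_cos, Real.tan_eq_sin_div_cos]
  simp only [Real.cos_two_mul, Real.sin_two_mul] at h3
  have sx := Real.sin_sq_add_cos_sq x
  have sy := Real.sin_sq_add_cos_sq y
  have sa := Real.sin_sq_add_cos_sq α
  have sp := Real.sin_pos_of_mem_Ioo hα
  field_simp
  apply mul_left_cancel₀ c4
  linear_combination h3 + 4 * cos α * cos y ^ 2 * (sin α ^ 2 * sx - sin x ^ 2 * sa) + cos α * sa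
end

section
/- Consider a developable bird's-foot degree-4 rigid origami vertex: sector angles α₁ = α₂ = α ∈ (0, π) and α₃ = α₄ = π − α. If (ρ₁, ρ₂, ρ₃, ρ₄) satisfies the rotation-matrix closure condition with ρ₁, ρ₂, ρ₄ ∈ (−π, π) and ρ₁ ≠ 0, then tan(ρ₄/2) = cos α · tan(ρ₁/2) and tan(ρ₂/2) = −cos α · tan(ρ₁/2). -/
open Real Matrix

lemma Rz_mul_aux (a b : ℝ) : Rz a * Rz b = Rz (a + b) := by
  ext i j
  fin_cases i <;> fin_cases j <;>
    simp [Rz, Matrix.mul_apply, Fin.sum_univ_three, Real.cos_add, Real.sin_add] <;> ring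

lemma Rz_pi_aux : Rz π = !![-1, 0, 0; 0, -1, 0; 0, 0, 1] := by
  simp [Rz]

lemma Rx_conj_aux (r : ℝ) : Rx r * Rz π * Rx r = Rz π := by
  rw [Rz_pi_aux]
  have h := Real.sin_sq_add_cos_sq r
  ext i j
  fin_cases i <;> fin_cases j <;>
    simp [Rx, Matrix.mul_apply, Fin.sum_univ_three] <;> first | linarith | ring

lemma Rz_zero_aux : Rz (π + π) = 1 := by
  have h1 : Real.cos (π + π) = 1 := by rw [← two_mul]; exact Real.cos_two_pi
  have h2 : Real.sin (π + π) = 0 := by rw [← two_mul]; exact Real.sin_two_pi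
  ext i j
  fin_cases i <;> fin_cases j <;> simp [Rz, h1, h2]

lemma B_aux (α r : ℝ) :
    (Rz (π - α) * Rx r * Rz (π - α)) * (Rz α * Rx r * Rz α) = 1 := by
  calc (Rz (π - α) * Rx r * Rz (π - α)) * (Rz α * Rx r * Rz α)
      = Rz (π - α) * (Rx r * (Rz (π - α) * Rz α) * Rx r) * Rz α := by
        simp only [Matrix.mul_assoc]
    _ = 1 := by
        rw [Rz_mul_aux, sub_add_cancel, Rx_conj_aux, Rz_mul_aux, Rz_mul_aux,
          ← Rz_zero_aux]
        congr 1; ring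

lemma tan_half_aux (r : ℝ) (h : Real.cos (r / 2) ≠ 0) :
    Real.sin r = Real.tan (r / 2) * (1 + Real.cos r) := by
  have e : r = 2 * (r / 2) := by ring
  rw [Real.tan_eq_sin_div_cos]
  conv_lhs => rw [e, Real.sin_two_mul]
  conv_rhs => rw [show Real.cos r = 2 * Real.cos (r / 2) ^ 2 - 1 by
    rw [← Real.cos_two_mul]; congr 1]
  field_simp
  ring

lemma cos_half_aux (r : ℝ) (h : r ∈ Set.Ioo (-π) π) : 0 < Real.cos (r / 2) :=
  Real.cos_pos_of_mem_Ioo ⟨by linarith [h.1], by linarith [h.2]⟩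

lemma one_add_cos_aux (r : ℝ) (h : r ∈ Set.Ioo (-π) π) : 0 < 1 + Real.cos r := by
  have h1 := cos_half_aux r h
  have : Real.cos r = 2 * Real.cos (r / 2) ^ 2 - 1 := by
    rw [← Real.cos_two_mul]; congr 1; ring
  rw [this]; nlinarith

/-- Folding-angle relations for the nontrivial mode of a developable bird's-foot
(Miura-ori) degree-4 vertex. -/
theorem miura_vertex_mode (α ρ₁ ρ₂ ρ₃ ρ₄ : ℝ)
    (hα : α ∈ Set.Ioo 0 π)
    (hρ₁ : ρ₁ ∈ Set.Ioo (-π) π) (hρ₂ : ρ₂ ∈ Set.Ioo (-π) π) (hρ₄ : ρ₄ ∈ Set.Ioo (-π) π)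
    (hρ₁0 : ρ₁ ≠ 0)
    (hclose : ClosureCond α α (π - α) (π - α) ρ₁ ρ₂ ρ₃ ρ₄) :
    Real.tan (ρ₄ / 2) = Real.cos α * Real.tan (ρ₁ / 2) ∧
    Real.tan (ρ₂ / 2) = -(Real.cos α * Real.tan (ρ₁ / 2)) := by
  have hs : 0 < Real.sin α := Real.sin_pos_of_pos_of_lt_pi hα.1 hα.2
  have key : Rx ρ₁ * (Rz α * Rx ρ₂ * Rz α) * Rx ρ₃ = Rz α * Rx ρ₄ * Rz α := by
    unfold ClosureCond at hclose
    calc Rx ρ₁ * (Rz α * Rx ρ₂ * Rz α) * Rx ρ₃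
        = Rx ρ₁ * (Rz α * Rx ρ₂ * Rz α) * Rx ρ₃ *
          ((Rz (π - α) * Rx ρ₄ * Rz (π - α)) * (Rz α * Rx ρ₄ * Rz α)) := by
          rw [B_aux, Matrix.mul_one]
      _ = (Rx ρ₁ * Rz α * Rx ρ₂ * Rz α * Rx ρ₃ * Rz (π - α) * Rx ρ₄ * Rz (π - α)) *
          (Rz α * Rx ρ₄ * Rz α) := by simp only [Matrix.mul_assoc]
      _ = _ := by rw [hclose, Matrix.one_mul]
  have k0 := congr_fun (congr_fun key 0) 0
  have k1 := congr_fun (congr_fun key 1) 0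
  have k2 := congr_fun (congr_fun key 2) 0
  simp [Rx, Rz, Matrix.mul_apply, Fin.sum_univ_three] at k0 k1 k2
  have t1 := tan_half_aux ρ₁ (cos_half_aux ρ₁ hρ₁).ne'
  have t2 := tan_half_aux ρ₂ (cos_half_aux ρ₂ hρ₂).ne'
  have t4 := tan_half_aux ρ₄ (cos_half_aux ρ₄ hρ₄).ne'
  have p1 := one_add_cos_aux ρ₁ hρ₁
  have p2 := one_add_cos_aux ρ₂ hρ₂
  have hsin : Real.sin ρ₁ ≠ 0 := fun h =>
    hρ₁0 ((Real.sin_eq_zero_iff_of_lt_of_lt hρ₁.1 hρ₁.2).1 h)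
  have q1 := Real.sin_sq_add_cos_sq ρ₁
  generalize Real.tan (ρ₁ / 2) = x1 at *
  generalize Real.tan (ρ₂ / 2) = x2 at *
  generalize Real.tan (ρ₄ / 2) = x4 at *
  have hC : Real.cos ρ₂ = Real.cos ρ₄ := by
    exact k0.resolve_right hs.ne'
  rw [← hC] at k1 t4
  rw [t2] at k1 k2
  rw [t4] at k2
  have hne : Real.sin α * (1 + Real.cos ρ₂) ≠ 0 := (mul_pos hs p2).ne'
  have e1 : Real.cos ρ₁ * Real.cos α - Real.sin ρ₁ * x2 = Real.cos α := by
    apply mul_left_cancel₀ hne; linarith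
  have e2 : Real.sin ρ₁ * Real.cos α + Real.cos ρ₁ * x2 = x4 := by
    apply mul_left_cancel₀ hne; linarith
  have hx : Real.sin ρ₁ * x1 = 1 - Real.cos ρ₁ := by
    apply mul_left_cancel₀ p1.ne'
    linear_combination (-Real.sin ρ₁) * t1 + q1
  have e3 : x2 = -(Real.cos α * x1) := by
    apply mul_left_cancel₀ hsin
    linear_combination -e1 + Real.cos α * hx
  refine ⟨?_, e3⟩
  rw [← e2, e3, t1]; ring
end

section
/- Consider a developable bird's-foot degree-4 rigid origami vertex: sector angles α₁ = α₂ = α ∈ (0, π) and α₃ = α₄ = π − α. If (ρ₁, ρ₂, ρ₃, ρ₄) satisfies the rotation-matrix closure condition with every ρⱼ ∈ (−π, π] and ρ₁ = 0, then ρ₃ = 0 and ρ₂ = ρ₄; that is, the folding mode with the two 'toe' creases unfolded is the fold of the straight line formed by creases e₂ and e₄. -/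
open Real Matrix

/-- The trivial mode of a developable bird's-foot (Miura-ori) degree-4 vertex:
with the toe creases unfolded, the vertex just folds along the line `e₂ ↔ e₄`. -/
theorem miura_vertex_trivial_mode (α ρ₁ ρ₂ ρ₃ ρ₄ : ℝ)
    (hα : α ∈ Set.Ioo 0 π)
    (hρ₁ : ρ₁ ∈ Set.Ioc (-π) π) (hρ₂ : ρ₂ ∈ Set.Ioc (-π) π)
    (hρ₃ : ρ₃ ∈ Set.Ioc (-π) π) (hρ₄ : ρ₄ ∈ Set.Ioc (-π) π)
    (hρ₁0 : ρ₁ = 0)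
    (hclose : ClosureCond α α (π - α) (π - α) ρ₁ ρ₂ ρ₃ ρ₄) :
    ρ₃ = 0 ∧ ρ₂ = ρ₄ := by
  obtain ⟨h0, hπ⟩ := hα
  have hs : 0 < Real.sin α := Real.sin_pos_of_pos_of_lt_pi h0 hπ
  subst hρ₁0
  have hx0 : Rx 0 = 1 := by
    ext i j; fin_cases i <;> fin_cases j <;> simp [Rx]
  have hD : Rz (π - α) * Rz α = !![-1, 0, 0; 0, -1, 0; 0, 0, 1] := by
    have := Real.sin_sq_add_cos_sq α
    ext i j; fin_cases i <;> fin_cases j <;>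
      simp [Rz, Matrix.mul_apply, Fin.sum_univ_three] <;> linarith
  have hD' : Rz α * Rz (π - α) = !![-1, 0, 0; 0, -1, 0; 0, 0, 1] := by
    have := Real.sin_sq_add_cos_sq α
    ext i j; fin_cases i <;> fin_cases j <;>
      simp [Rz, Matrix.mul_apply, Fin.sum_univ_three] <;> linarith
  unfold ClosureCond at hclose
  rw [hx0, one_mul, mul_eq_one_comm] at hclose
  have h1 : Rz (π - α) * Rz α * (Rx ρ₂ * (Rz α * Rx ρ₃ * Rz (π - α)) * Rx ρ₄) = 1 := by
    rw [← hclose]; simp only [Matrix.mul_assoc]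
  rw [hD] at h1
  have h3 : ρ₃ = 0 := by
    have h := congrFun (congrFun h1 0) 0
    simp [Rx, Rz, Matrix.mul_apply, Fin.sum_univ_three] at h
    have hsc := Real.sin_sq_add_cos_sq α
    have h' : Real.sin α ^ 2 * (Real.cos ρ₃ - 1) = 0 := by linarith
    have hc : Real.cos ρ₃ = 1 := by
      rcases mul_eq_zero.mp h' with h | h
      · exact absurd h (by positivity)
      · linarith
    exact (Real.cos_eq_one_iff_of_lt_of_lt (by linarith [hρ₃.1, Real.pi_pos])
      (by linarith [hρ₃.2, Real.pi_pos])).mp hc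
  refine ⟨h3, ?_⟩
  rw [h3, hx0, mul_one, hD'] at h1
  have h := congrFun (congrFun h1 1) 1
  simp [Rx, Matrix.mul_apply, Fin.sum_univ_three] at h
  have hc : Real.cos (ρ₂ - ρ₄) = 1 := by
    rw [Real.cos_sub]; linarith
  have := (Real.cos_eq_one_iff_of_lt_of_lt (by linarith [hρ₂.1, hρ₄.2])
      (by linarith [hρ₂.2, hρ₄.1])).mp hc
  linarith
end

section
/- Let θ ∈ (π/4, 3π/4) and consider the square-twist-pouch degree-4 vertex with sector angles α₁ = θ, α₂ = 3π/4 − θ, α₃ = 3π/4, α₄ = π/2 (these sum to 2π). If (ρ₁, ρ₂, ρ₃, ρ₄) satisfies the rotation-matrix closure condition with ρ₁, ρ₄ ∈ (−π, π), ρ₁ = ρ₄, and ρ₁ ≠ 0, then cos ρ₁ = −cot θ; equivalently, the only nonzero folding angle at which the two creases bounding the sector α₄ fold by equal amounts is ρ₁ = ±(π − arccos(cot θ)). -/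
open Real Matrix

theorem Rx_inv1 (b : ℝ) (M : Matrix (Fin 3) (Fin 3) ℝ) : Rx (-b) * (Rx b * M) = M := by
  have h : Rx (-b) * Rx b = 1 := by
    have := Real.sin_sq_add_cos_sq b
    ext i j
    fin_cases i <;> fin_cases j <;>
      simp [Rx, Matrix.mul_apply, Fin.sum_univ_three] <;> linarith
  rw [← Matrix.mul_assoc, h, Matrix.one_mul]

theorem Rz_inv1 (b : ℝ) (M : Matrix (Fin 3) (Fin 3) ℝ) : Rz (-b) * (Rz b * M) = M := by
  have h : Rz (-b) * Rz b = 1 := by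
    have := Real.sin_sq_add_cos_sq b
    ext i j
    fin_cases i <;> fin_cases j <;>
      simp [Rz, Matrix.mul_apply, Fin.sum_univ_three] <;> linarith
  rw [← Matrix.mul_assoc, h, Matrix.one_mul]

theorem Rx_inv2 (b : ℝ) (M : Matrix (Fin 3) (Fin 3) ℝ) : Rx b * (Rx (-b) * M) = M := by
  simpa using Rx_inv1 (-b) M

theorem Rz_inv2 (b : ℝ) (M : Matrix (Fin 3) (Fin 3) ℝ) : Rz b * (Rz (-b) * M) = M := by
  simpa using Rz_inv1 (-b) M

/-- Square-twist pouch vertex: the only nonzero folding angle with `ρ₁ = ρ₄`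
satisfies `cos ρ₁ = -cot θ`. -/
theorem square_twist_pouch (θ ρ₁ ρ₂ ρ₃ ρ₄ : ℝ)
    (hθ : θ ∈ Set.Ioo (π / 4) (3 * π / 4))
    (hρ₁ : ρ₁ ∈ Set.Ioo (-π) π) (hρ₄ : ρ₄ ∈ Set.Ioo (-π) π)
    (heq : ρ₁ = ρ₄) (hρ₁0 : ρ₁ ≠ 0)
    (hclose : ClosureCond θ (3 * π / 4 - θ) (3 * π / 4) (π / 2) ρ₁ ρ₂ ρ₃ ρ₄) :
    Real.cos ρ₁ = -Real.cot θ := by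
  subst heq
  have hc1 : Real.cos ρ₁ ≠ 1 := by
    intro h
    exact hρ₁0 ((Real.cos_eq_one_iff_of_lt_of_lt (by linarith [hρ₁.1, Real.pi_pos])
      (by linarith [hρ₁.2, Real.pi_pos])).1 h)
  have hs : 0 < Real.sin θ := Real.sin_pos_of_pos_of_lt_pi
    (by linarith [hθ.1, Real.pi_pos]) (by linarith [hθ.2, Real.pi_pos])
  have key : Rx ρ₂ * (Rz (3 * π / 4 - θ) * Rx ρ₃) =
      Rz (-θ) * (Rx (-ρ₁) * (1 * (Rz (-(π/2)) * (Rx (-ρ₁) * Rz (-(3 * π / 4)))))) := by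
    unfold ClosureCond at hclose
    generalize hN : Rz (-(π/2)) * (Rx (-ρ₁) * Rz (-(3 * π / 4))) = N
    rw [← hclose, ← hN]
    simp only [Matrix.mul_assoc, Rx_inv1, Rz_inv1, Rx_inv2, Rz_inv2]
    have h := Rz_inv2 (3 * π / 4) 1
    rw [Matrix.mul_one] at h
    rw [h, Matrix.mul_one]
  have e := congrFun (congrFun key 0) 0
  have hs3 : Real.sin (3 * π / 4) = √2 / 2 := by
    rw [show 3 * π / 4 = π - π / 4 by ring, Real.sin_pi_sub, Real.sin_pi_div_four]
  have hc3 : Real.cos (3 * π / 4) = -(√2 / 2) := by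
    rw [show 3 * π / 4 = π - π / 4 by ring, Real.cos_pi_sub, Real.cos_pi_div_four]
  simp [Rx, Rz, Matrix.mul_apply, Fin.sum_univ_three, Real.cos_sub, hs3, hc3] at e
  have h2 : (0:ℝ) < √2 := by positivity
  have hsq := Real.sin_sq_add_cos_sq ρ₁
  have e2 : √2 * (1 - Real.cos ρ₁) * (Real.cos θ + Real.sin θ * Real.cos ρ₁) = 0 := by
    linear_combination (-2) * e - √2 * Real.sin θ * hsq
  have e3 : Real.cos θ + Real.sin θ * Real.cos ρ₁ = 0 := by
    rcases mul_eq_zero.1 e2 with h | h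
    · rcases mul_eq_zero.1 h with h | h
      · exact absurd h h2.ne'
      · exact absurd (by linarith) hc1
    · exact h
  rw [Real.cot_eq_cos_div_sin]
  field_simp
  linarith
end

section
/- Consider the hyperbolic (non-developable) degree-4 vertex used in the folding table, with sector angles α₁ = α₂ = 5π/8, α₃ = π/2, α₄ = 3π/4 (these sum to 5π/2 > 2π). If (ρ₁, ρ₂, ρ₃, ρ₄) satisfies the rotation-matrix closure condition with ρ₂, ρ₄ ∈ (−π, π), then tan²(ρ₂/2) · (2 + √2 · cos ρ₄) = 2√2 · sin²(ρ₄/2). -/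
open Real Matrix

lemma Rz_mul_tr (a : ℝ) : Rz a * (Rz a)ᵀ = 1 := by
  have h := Real.sin_sq_add_cos_sq a
  ext i j
  fin_cases i <;> fin_cases j <;>
    simp [Rz, Matrix.mul_apply, Fin.sum_univ_three] <;> linarith

lemma Rx_mul_tr (a : ℝ) : Rx a * (Rx a)ᵀ = 1 := by
  have h := Real.sin_sq_add_cos_sq a
  ext i j
  fin_cases i <;> fin_cases j <;>
    simp [Rx, Matrix.mul_apply, Fin.sum_univ_three] <;> linarith

lemma closure_opp (a b c d r s t u : ℝ) (h : ClosureCond a b c d r s t u) :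
    cos a * cos b - sin a * sin b * cos s = cos c * cos d - sin c * sin d * cos u := by
  unfold ClosureCond at h
  have hB : (Rz c * Rx u * Rz d) * (Rz c * Rx u * Rz d)ᵀ = 1 := by
    rw [Matrix.transpose_mul, Matrix.transpose_mul]
    calc _ = Rz c * (Rx u * (Rz d * (Rz d)ᵀ) * (Rx u)ᵀ) * (Rz c)ᵀ := by
          simp only [Matrix.mul_assoc]
      _ = 1 := by rw [Rz_mul_tr, Matrix.mul_one, Rx_mul_tr, Matrix.mul_one, Rz_mul_tr]
  have hM : Rx r * (Rz a * Rx s * Rz b) * Rx t = (Rz c * Rx u * Rz d)ᵀ := by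
    have h2 : (Rx r * (Rz a * Rx s * Rz b) * Rx t) * (Rz c * Rx u * Rz d) = 1 := by
      rw [← h]; simp only [Matrix.mul_assoc]
    calc _ = (Rx r * (Rz a * Rx s * Rz b) * Rx t) *
          ((Rz c * Rx u * Rz d) * (Rz c * Rx u * Rz d)ᵀ) := by rw [hB, Matrix.mul_one]
      _ = _ := by rw [← Matrix.mul_assoc, h2, Matrix.one_mul]
  have h0 := congrFun (congrFun hM 0) 0
  simp [Rx, Rz, Matrix.mul_apply, Fin.sum_univ_three] at h0
  linarith

/-- Eq. (13): the opposite-folding-angle relation for the hyperbolic folding-table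
vertex with sector angles `(5π/8, 5π/8, π/2, 3π/4)`. -/
theorem folding_table_vertex (ρ₁ ρ₂ ρ₃ ρ₄ : ℝ)
    (hρ₂ : ρ₂ ∈ Set.Ioo (-π) π) (hρ₄ : ρ₄ ∈ Set.Ioo (-π) π)
    (hclose : ClosureCond (5 * π / 8) (5 * π / 8) (π / 2) (3 * π / 4) ρ₁ ρ₂ ρ₃ ρ₄) :
    Real.tan (ρ₂ / 2) ^ 2 * (2 + Real.sqrt 2 * Real.cos ρ₄)
      = 2 * Real.sqrt 2 * Real.sin (ρ₄ / 2) ^ 2 := by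
  have h := closure_opp _ _ _ _ _ _ _ _ hclose
  have e1 : cos (3 * π / 4) = -(√2 / 2) := by
    rw [show 3 * π / 4 = π - π / 4 by ring, cos_pi_sub, cos_pi_div_four]
  have e2 : sin (3 * π / 4) = √2 / 2 := by
    rw [show 3 * π / 4 = π - π / 4 by ring, sin_pi_sub, sin_pi_div_four]
  have e3 : cos (5 * π / 8) ^ 2 = 1 / 2 - √2 / 4 := by
    rw [cos_sq, show 2 * (5 * π / 8) = π / 4 + π by ring, cos_add_pi, cos_pi_div_four]; ring
  have e4 : sin (5 * π / 8) ^ 2 = 1 / 2 + √2 / 4 := by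
    rw [sin_sq, e3]; ring
  rw [e1, e2, cos_pi_div_two, sin_pi_div_two, ← sq, ← sq, e3, e4] at h
  have hs : √2 ^ 2 = 2 := Real.sq_sqrt (by norm_num)
  have hc : 0 < cos (ρ₂ / 2) :=
    cos_pos_of_mem_Ioo ⟨by linarith [hρ₂.1], by linarith [hρ₂.2]⟩
  have f2 : cos ρ₂ = 2 * cos (ρ₂ / 2) ^ 2 - 1 := by
    rw [← cos_two_mul]; congr 1; ring
  have f4 : sin (ρ₄ / 2) ^ 2 = (1 - cos ρ₄) / 2 := by
    rw [sin_sq, cos_sq, show 2 * (ρ₄ / 2) = ρ₄ by ring]; ring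
  rw [f2] at h
  rw [f4, tan_eq_sin_div_cos, div_pow, sin_sq]
  generalize cos (ρ₂ / 2) = x at *
  generalize cos ρ₄ = y at *
  have hk : (2 + √2) * x ^ 2 = 2 + √2 * y := by linarith
  rw [← hk]
  field_simp
  linear_combination -hk
end

section
/- Let α₁, α₂, α₃, α₄ ∈ (0, π) and t, ρ₁, ρ₂ ∈ ℝ. Let p_l = (cos(α₃+α₄), −sin(α₃+α₄), 0) and p_r = (cos(α₁+α₂), sin(α₁+α₂), 0) in ℝ³. Then the x-coordinate of Rz(−α₄)·Rx(t)·Rz(α₄)·p_l equals cos α₃ cos α₄ − sin α₃ sin α₄ cos t, the x-coordinate of Rx(ρ₁)·Rz(α₁)·Rx(ρ₂)·Rz(−α₁)·p_r equals cos α₁ cos α₂ − sin α₁ sin α₂ cos ρ₂ (in particular it is independent of ρ₁), and these two x-coordinates are equal if and only if cos ρ₂ = cot α₁ · cot α₂ + (sin α₃ · sin α₄ · cos t − cos α₃ · cos α₄)/(sin α₁ · sin α₂). -/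
open Real Matrix

/-- Appendix A: the x-coordinates of the two folded images of `p_l` and `p_r`,
and the resulting equation (Eq. (A3)) for `cos ρ₂`. -/
theorem x_coordinate_matching (α₁ α₂ α₃ α₄ t ρ₁ ρ₂ : ℝ)
    (hα₁ : α₁ ∈ Set.Ioo 0 π) (hα₂ : α₂ ∈ Set.Ioo 0 π)
    (hα₃ : α₃ ∈ Set.Ioo 0 π) (hα₄ : α₄ ∈ Set.Ioo 0 π) :
    ((Rz (-α₄) * Rx t * Rz α₄).mulVec
        ![Real.cos (α₃ + α₄), -Real.sin (α₃ + α₄), 0]) 0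
      = Real.cos α₃ * Real.cos α₄ - Real.sin α₃ * Real.sin α₄ * Real.cos t ∧
    ((Rx ρ₁ * Rz α₁ * Rx ρ₂ * Rz (-α₁)).mulVec
        ![Real.cos (α₁ + α₂), Real.sin (α₁ + α₂), 0]) 0
      = Real.cos α₁ * Real.cos α₂ - Real.sin α₁ * Real.sin α₂ * Real.cos ρ₂ ∧
    (((Rz (-α₄) * Rx t * Rz α₄).mulVec
          ![Real.cos (α₃ + α₄), -Real.sin (α₃ + α₄), 0]) 0
        = ((Rx ρ₁ * Rz α₁ * Rx ρ₂ * Rz (-α₁)).mulVec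
            ![Real.cos (α₁ + α₂), Real.sin (α₁ + α₂), 0]) 0
      ↔ Real.cos ρ₂ = Real.cot α₁ * Real.cot α₂ +
          (Real.sin α₃ * Real.sin α₄ * Real.cos t - Real.cos α₃ * Real.cos α₄) /
            (Real.sin α₁ * Real.sin α₂)) := by
  have h1 : ((Rz (-α₄) * Rx t * Rz α₄).mulVec
        ![Real.cos (α₃ + α₄), -Real.sin (α₃ + α₄), 0]) 0
      = Real.cos α₃ * Real.cos α₄ - Real.sin α₃ * Real.sin α₄ * Real.cos t := by
    have e := Real.sin_sq_add_cos_sq α₄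
    simp [Rz, Rx, Matrix.mulVec, dotProduct, Matrix.mul_apply, Fin.sum_univ_three,
      Real.cos_add, Real.sin_add]
    linear_combination (Real.cos α₃ * Real.cos α₄ - Real.sin α₃ * Real.sin α₄ * Real.cos t) * e
  have h2 : ((Rx ρ₁ * Rz α₁ * Rx ρ₂ * Rz (-α₁)).mulVec
        ![Real.cos (α₁ + α₂), Real.sin (α₁ + α₂), 0]) 0
      = Real.cos α₁ * Real.cos α₂ - Real.sin α₁ * Real.sin α₂ * Real.cos ρ₂ := by
    have e := Real.sin_sq_add_cos_sq α₁
    simp [Rz, Rx, Matrix.mulVec, dotProduct, Matrix.mul_apply, Fin.sum_univ_three,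
      Real.cos_add, Real.sin_add]
    linear_combination (Real.cos α₁ * Real.cos α₂ - Real.sin α₁ * Real.sin α₂ * Real.cos ρ₂) * e
  refine ⟨h1, h2, ?_⟩
  rw [h1, h2]
  have s1 : Real.sin α₁ ≠ 0 := (Real.sin_pos_of_mem_Ioo hα₁).ne'
  have s2 : Real.sin α₂ ≠ 0 := (Real.sin_pos_of_mem_Ioo hα₂).ne'
  rw [Real.cot_eq_cos_div_sin, Real.cot_eq_cos_div_sin, div_mul_div_comm, ← add_div,
    eq_div_iff (mul_ne_zero s1 s2)]
  constructor <;> intro h <;> linear_combination h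
end

section
/- Let α₁, α₂, α₃, α₄ ∈ (0, π) and ρ₁, ρ₄ ∈ (−π, π). Define T₁ = Rx(ρ₁)·(cos α₁, sin α₁, 0) and T₂ = Rz(−α₄)·Rx(−ρ₄)·Rz(α₄)·(cos(α₃+α₄), −sin(α₃+α₄), 0) in ℝ³. Then the Euclidean inner product satisfies T₁ · T₂ = cos α₂ if and only if, writing x = tan(ρ₄/2) and y = tan(ρ₁/2), cos(α₁+α₃+α₄) + x²·cos(α₁−α₃+α₄) + y²·cos(α₁−α₃−α₄) + x²·y²·cos(α₁+α₃−α₄) + 4·x·y·sin α₁·sin α₃ = (1+x²)·(1+y²)·cos α₂. -/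
open Real Matrix

theorem half_tan_aux (r : ℝ) (h : r ∈ Set.Ioo (-π) π) :
    Real.cos r = (1 - Real.tan (r / 2) ^ 2) / (1 + Real.tan (r / 2) ^ 2) ∧
    Real.sin r = 2 * Real.tan (r / 2) / (1 + Real.tan (r / 2) ^ 2) := by
  have hc : Real.cos (r / 2) ≠ 0 :=
    (Real.cos_pos_of_mem_Ioo ⟨by linarith [h.1], by linarith [h.2]⟩).ne'
  have h1 : Real.cos r = 2 * Real.cos (r / 2) ^ 2 - 1 := by
    rw [← Real.cos_two_mul]; congr 1; ring
  have h2 : Real.sin r = 2 * Real.sin (r / 2) * Real.cos (r / 2) := by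
    rw [← Real.sin_two_mul]; congr 1; ring
  have h3 := Real.sin_sq_add_cos_sq (r / 2)
  have h4 : 1 + Real.tan (r / 2) ^ 2 = 1 / Real.cos (r / 2) ^ 2 := by
    rw [Real.tan_eq_sin_div_cos]; field_simp; linarith
  rw [h4, h1, h2, Real.tan_eq_sin_div_cos]
  constructor
  · field_simp; linarith
  · field_simp

/-- Appendix A, Eq. (A6): the adjacent-angle condition `T₁ · T₂ = cos α₂` is
equivalent to the polynomial identity in `x = tan(ρ₄/2)`, `y = tan(ρ₁/2)`. -/
theorem adjacent_condition_weierstrass (α₁ α₂ α₃ α₄ ρ₁ ρ₄ : ℝ)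
    (hα₁ : α₁ ∈ Set.Ioo 0 π) (hα₂ : α₂ ∈ Set.Ioo 0 π)
    (hα₃ : α₃ ∈ Set.Ioo 0 π) (hα₄ : α₄ ∈ Set.Ioo 0 π)
    (hρ₁ : ρ₁ ∈ Set.Ioo (-π) π) (hρ₄ : ρ₄ ∈ Set.Ioo (-π) π) :
    ((Rx ρ₁).mulVec ![Real.cos α₁, Real.sin α₁, 0]) ⬝ᵥ
        ((Rz (-α₄) * Rx (-ρ₄) * Rz α₄).mulVec
          ![Real.cos (α₃ + α₄), -Real.sin (α₃ + α₄), 0]) = Real.cos α₂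
    ↔ Real.cos (α₁ + α₃ + α₄)
        + Real.tan (ρ₄ / 2) ^ 2 * Real.cos (α₁ - α₃ + α₄)
        + Real.tan (ρ₁ / 2) ^ 2 * Real.cos (α₁ - α₃ - α₄)
        + Real.tan (ρ₄ / 2) ^ 2 * Real.tan (ρ₁ / 2) ^ 2 * Real.cos (α₁ + α₃ - α₄)
        + 4 * Real.tan (ρ₄ / 2) * Real.tan (ρ₁ / 2) * Real.sin α₁ * Real.sin α₃
      = (1 + Real.tan (ρ₄ / 2) ^ 2) * (1 + Real.tan (ρ₁ / 2) ^ 2) * Real.cos α₂ := by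
  obtain ⟨hc1, hs1⟩ := half_tan_aux ρ₁ hρ₁
  obtain ⟨hc4, hs4⟩ := half_tan_aux ρ₄ hρ₄
  have e : (Rz α₄).mulVec ![Real.cos (α₃ + α₄), -Real.sin (α₃ + α₄), 0]
      = ![Real.cos α₃, -Real.sin α₃, 0] := by
    have a : Real.cos α₃ = Real.cos (α₃ + α₄ - α₄) := by congr 1; ring
    have b : Real.sin α₃ = Real.sin (α₃ + α₄ - α₄) := by congr 1; ring
    rw [a, b, Real.cos_sub, Real.sin_sub]
    ext i
    fin_cases i <;> simp [Rz, Matrix.mulVec, dotProduct, Fin.sum_univ_three] <;> ring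
  rw [← Matrix.mulVec_mulVec, e, ← Matrix.mulVec_mulVec]
  have key : ((Rx ρ₁).mulVec ![Real.cos α₁, Real.sin α₁, 0]) ⬝ᵥ
        ((Rz (-α₄)).mulVec ((Rx (-ρ₄)).mulVec ![Real.cos α₃, -Real.sin α₃, 0]))
      = Real.cos α₁ * (Real.cos α₄ * Real.cos α₃ - Real.sin α₄ * Real.sin α₃ * Real.cos ρ₄)
        - Real.sin α₁ * Real.cos ρ₁ *
          (Real.sin α₄ * Real.cos α₃ + Real.cos α₄ * Real.sin α₃ * Real.cos ρ₄)
        + Real.sin α₁ * Real.sin ρ₁ * Real.sin α₃ * Real.sin ρ₄ := by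
    simp [Rx, Rz, Matrix.mulVec, dotProduct, Fin.sum_univ_three]
    ring
  rw [key, hc1, hs1, hc4, hs4]
  simp only [Real.cos_add, Real.cos_sub, Real.sin_add, Real.sin_sub]
  generalize Real.tan (ρ₄ / 2) = x
  generalize Real.tan (ρ₁ / 2) = y
  have hx : 1 + x ^ 2 ≠ 0 := by positivity
  have hy : 1 + y ^ 2 ≠ 0 := by positivity
  rw [← mul_right_inj' (mul_ne_zero hx hy)]
  refine Eq.congr ?_ rfl
  field_simp
  ring
end
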